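/- There exist absolute constants C, c > 0 such that the following holds. Fix any w ∈ R_loc with β = ‖P^⊥ w‖ > 0. If d ≥ C and n ≥ C·e^{C/β²}, then with probability at least 1 − C e^{−c d} − C/n − e^{−c e^{−C/β²} √n} over the draw of x_1, …, x_n, one has min_{u ∈ S^{d−1}} u^⊤ ∇²L(w) u ≤ −c β² (d log n)/n + C. -/

import Mathlib

open MeasureTheory ProbabilityTheory Real

noncomputable section

/-- Euclidean inner product on `Fin d → ℝ`. -/
def dot {d : ℕ} (u v : Fin d → ℝ) : ℝ := ∑ j, u j * v j

/-- Euclidean norm on `Fin d → ℝ`. -/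
def nrm {d : ℕ} (u : Fin d → ℝ) : ℝ := Real.sqrt (∑ j, (u j) ^ 2)

/-- Standard Gaussian `N(0, I_d)` on `Fin d → ℝ`. -/
def stdGaussian (d : ℕ) : Measure (Fin d → ℝ) := Measure.pi fun _ => gaussianReal 0 1

/-- Law of `n` i.i.d. draws from `N(0, I_d)`. -/
def sample (n d : ℕ) : Measure (Fin n → Fin d → ℝ) := Measure.pi fun _ => stdGaussian d

/-- The Hessian quadratic form `u^⊤ ∇²L(w) u` of the phase retrieval loss. -/
def hessQF {n d : ℕ} (wstar w u : Fin d → ℝ) (x : Fin n → Fin d → ℝ) : ℝ :=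
  (1 / n) * ∑ i, (3 * (dot w (x i)) ^ 2 - (dot wstar (x i)) ^ 2) * (dot u (x i)) ^ 2

/-- Orthogonal component `P^⊥ w = w - ⟨w, w*⟩ w*`. -/
def perpPart {d : ℕ} (wstar w : Fin d → ℝ) : Fin d → ℝ := w - dot w wstar • wstar

/-- The local region `R_loc = {w = α w* + β w^⊥ : |α - 1| ≤ 1/3, β ∈ (0,1]}`. -/
def Rloc {d : ℕ} (wstar w : Fin d → ℝ) : Prop :=
  |dot w wstar - 1| ≤ 1 / 3 ∧ 0 < nrm (perpPart wstar w) ∧ nrm (perpPart wstar w) ≤ 1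


instance (d : ℕ) : IsProbabilityMeasure (_root_.stdGaussian d) := by
  unfold _root_.stdGaussian; infer_instance

lemma dot_comm' {d : ℕ} (u v : Fin d → ℝ) : dot u v = dot v u := by
  simp [dot, mul_comm]

lemma dot_add' {d : ℕ} (u v w : Fin d → ℝ) : dot u (v + w) = dot u v + dot u w := by
  simp [dot, mul_add, Finset.sum_add_distrib]

lemma dot_sub' {d : ℕ} (u v w : Fin d → ℝ) : dot u (v - w) = dot u v - dot u w := by
  simp [dot, mul_sub, Finset.sum_sub_distrib]

lemma dot_smul' {d : ℕ} (r : ℝ) (u v : Fin d → ℝ) : dot u (r • v) = r * dot u v := by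
  simp only [dot, Finset.mul_sum, Pi.smul_apply, smul_eq_mul]
  exact Finset.sum_congr rfl fun _ _ => by ring

lemma add_dot' {d : ℕ} (u v w : Fin d → ℝ) : dot (v + w) u = dot v u + dot w u := by
  rw [dot_comm', dot_add', dot_comm' u, dot_comm' u]

lemma sub_dot' {d : ℕ} (u v w : Fin d → ℝ) : dot (v - w) u = dot v u - dot w u := by
  rw [dot_comm', dot_sub', dot_comm' u, dot_comm' u]

lemma smul_dot' {d : ℕ} (r : ℝ) (u v : Fin d → ℝ) : dot (r • u) v = r * dot u v := by
  rw [dot_comm', dot_smul', dot_comm']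

lemma dot_self_nonneg' {d : ℕ} (u : Fin d → ℝ) : 0 ≤ dot u u :=
  Finset.sum_nonneg fun _ _ => mul_self_nonneg _

lemma nrm_eq' {d : ℕ} (u : Fin d → ℝ) : nrm u = Real.sqrt (dot u u) := by
  simp [nrm, dot, pow_two]

lemma nrm_sq' {d : ℕ} (u : Fin d → ℝ) : nrm u ^ 2 = dot u u := by
  rw [nrm_eq', Real.sq_sqrt (dot_self_nonneg' u)]

@[fun_prop]
lemma measurable_dot' {α : Type*} [MeasurableSpace α] {d : ℕ} {f g : α → Fin d → ℝ}
    (hf : Measurable f) (hg : Measurable g) : Measurable fun x => dot (f x) (g x) := by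
  unfold dot
  fun_prop

/-- characteristic function of the standard Gaussian -/
lemma cf_std {d : ℕ} (t : Fin d → ℝ) :
    ∫ z, Complex.exp (dot t z * Complex.I) ∂(_root_.stdGaussian d) =
      Complex.exp (-(dot t t : ℝ) / 2) := by
  have h1 : ∀ z : Fin d → ℝ, Complex.exp (dot t z * Complex.I) =
      ∏ j, Complex.exp (t j * z j * Complex.I) := by
    intro z
    rw [← Complex.exp_sum]
    simp [dot, Finset.sum_mul]
  simp_rw [h1]
  rw [_root_.stdGaussian, integral_fintype_prod_eq_prod (𝕜 := ℂ)
    (f := fun j (x : ℝ) => Complex.exp (t j * x * Complex.I))]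
  simp_rw [← charFun_apply_real, charFun_gaussianReal]
  rw [← Complex.exp_sum]
  congr 1
  simp [dot, Finset.sum_div, neg_div, pow_two]

lemma charFun_pi_map {d : ℕ} (ν : Measure (Fin d → ℝ)) (t : EuclideanSpace ℝ (Fin d)) :
    charFun (ν.map (WithLp.toLp 2)) t =
      ∫ z, Complex.exp (dot (WithLp.ofLp t) z * Complex.I) ∂ν := by
  rw [charFun_apply, integral_map (by fun_prop) (by fun_prop)]
  simp [dot, PiLp.inner_apply]

lemma eq_std_of_cf {d : ℕ} (ν : Measure (Fin d → ℝ)) [IsFiniteMeasure ν]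
    (h : ∀ t : Fin d → ℝ, ∫ z, Complex.exp (dot t z * Complex.I) ∂ν =
      Complex.exp (-(dot t t : ℝ) / 2)) : ν = _root_.stdGaussian d := by
  rw [_root_.stdGaussian, ← charFun_eq_pi_iff]
  intro t
  rw [charFun_pi_map, h, ← charFun_pi, charFun_pi_map]
  exact (cf_std _).symm

/-- linear functionals of a standard Gaussian -/
lemma map_dot_std {d : ℕ} (u : Fin d → ℝ) (hu : dot u u = 1) :
    (_root_.stdGaussian d).map (fun z => dot u z) = gaussianReal 0 1 := by
  have hm : Measurable (fun z : Fin d → ℝ => dot u z) := by fun_prop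
  have : IsProbabilityMeasure ((_root_.stdGaussian d).map (fun z => dot u z)) :=
    Measure.isProbabilityMeasure_map hm.aemeasurable
  apply Measure.ext_of_charFun
  ext t
  rw [charFun_gaussianReal, charFun_apply_real, integral_map hm.aemeasurable (by fun_prop)]
  have := cf_std (t • u)
  simp only [smul_dot', dot_smul', hu] at this
  convert this using 2
  · simp
  · push_cast; simp; ring

/-- projection on the orthogonal complement of two vectors -/
def prj {d : ℕ} (p q z : Fin d → ℝ) : Fin d → ℝ := z - dot p z • p - dot q z • q

def phi {d : ℕ} (p q : Fin d → ℝ) (y : (ℝ × ℝ) × (Fin d → ℝ)) : Fin d → ℝ :=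
  y.1.1 • p + y.1.2 • q + prj p q y.2

abbrev gg : Measure (ℝ × ℝ) := (gaussianReal 0 1).prod (gaussianReal 0 1)

@[fun_prop]
lemma measurable_prj {α : Type*} [MeasurableSpace α] {d : ℕ} (p q : Fin d → ℝ)
    {f : α → Fin d → ℝ} (hf : Measurable f) : Measurable fun x => prj p q (f x) := by
  unfold prj
  fun_prop

@[fun_prop]
lemma measurable_phi {d : ℕ} (p q : Fin d → ℝ) : Measurable (phi p q) := by
  unfold phi
  fun_prop

lemma dot_prj_comm {d : ℕ} (p q t z : Fin d → ℝ) : dot t (prj p q z) = dot (prj p q t) z := by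
  simp only [prj, dot_sub', sub_dot', dot_smul', smul_dot', dot_comm' t p, dot_comm' t q]
  ring

lemma dot_prj_prj {d : ℕ} {p q : Fin d → ℝ} (hp : dot p p = 1) (hq : dot q q = 1)
    (hpq : dot p q = 0) (t z : Fin d → ℝ) :
    dot (prj p q t) (prj p q z) = dot t z - dot p t * dot p z - dot q t * dot q z := by
  have hqp : dot q p = 0 := by rw [dot_comm', hpq]
  simp only [prj, dot_sub', sub_dot', dot_smul', smul_dot', dot_comm' t p, dot_comm' t q, hp, hq,
    hpq, hqp]
  ring

lemma map_phi {d : ℕ} {p q : Fin d → ℝ} (hp : dot p p = 1) (hq : dot q q = 1)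
    (hpq : dot p q = 0) : (gg.prod (_root_.stdGaussian d)).map (phi p q) = _root_.stdGaussian d := by
  have : IsProbabilityMeasure ((gg.prod (_root_.stdGaussian d)).map (phi p q)) :=
    Measure.isProbabilityMeasure_map (by fun_prop)
  apply eq_std_of_cf
  intro t
  rw [integral_map (by fun_prop) (Measurable.aestronglyMeasurable (by fun_prop))]
  have h1 : ∀ y : (ℝ × ℝ) × (Fin d → ℝ), Complex.exp (dot t (phi p q y) * Complex.I) =
      (Complex.exp (dot p t * y.1.1 * Complex.I) * Complex.exp (dot q t * y.1.2 * Complex.I)) *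
        Complex.exp (dot (prj p q t) y.2 * Complex.I) := by
    intro y
    rw [← Complex.exp_add, ← Complex.exp_add]
    congr 1
    simp only [phi, dot_add', dot_smul', dot_prj_comm, dot_comm' t p, dot_comm' t q]
    push_cast
    ring
  simp_rw [h1]
  rw [integral_prod_mul (f := fun y : ℝ × ℝ => Complex.exp (dot p t * y.1 * Complex.I) *
    Complex.exp (dot q t * y.2 * Complex.I))
    (g := fun z => Complex.exp (dot (prj p q t) z * Complex.I)), cf_std,
    integral_prod_mul (f := fun y : ℝ => Complex.exp (dot p t * y * Complex.I))
    (g := fun y : ℝ => Complex.exp (dot q t * y * Complex.I)), ← charFun_apply_real,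
    ← charFun_apply_real, charFun_gaussianReal, charFun_gaussianReal, ← Complex.exp_add,
    ← Complex.exp_add, dot_prj_prj hp hq hpq]
  congr 1
  push_cast
  simp
  ring

instance (n d : ℕ) : IsProbabilityMeasure (sample n d) := by
  unfold sample; infer_instance

def Phi {n d : ℕ} (p q : Fin d → ℝ) (y : (Fin n → ℝ × ℝ) × (Fin n → Fin d → ℝ)) :
    Fin n → Fin d → ℝ := fun i => phi p q (y.1 i, y.2 i)

lemma measurable_Phi {n d : ℕ} (p q : Fin d → ℝ) : Measurable (Phi (n := n) p q) := by
  unfold Phi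
  refine measurable_pi_lambda _ fun i => (measurable_phi p q).comp ?_
  fun_prop

lemma map_Phi {n d : ℕ} {p q : Fin d → ℝ} (hp : dot p p = 1) (hq : dot q q = 1)
    (hpq : dot p q = 0) :
    ((Measure.pi fun _ : Fin n => gg).prod (sample n d)).map (Phi p q) = sample n d := by
  have h := measurePreserving_arrowProdEquivProdArrow (ℝ × ℝ) (Fin d → ℝ) (Fin n)
    (fun _ => gg) (fun _ => _root_.stdGaussian d)
  conv_lhs => rw [sample, ← h.map_eq]
  rw [Measure.map_map (measurable_Phi p q) (MeasurableEquiv.measurable _)]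
  have : (Phi p q ∘ ⇑(MeasurableEquiv.arrowProdEquivProdArrow (ℝ × ℝ) (Fin d → ℝ) (Fin n))) =
    fun y i => phi p q (y i) := by
    rfl
  have hs : ∀ _ : Fin n, SigmaFinite
      ((gg.prod (_root_.stdGaussian d)).map (phi p q)) := by
    intro _; rw [map_phi hp hq hpq]; infer_instance
  rw [this, Measure.pi_map_pi (μ := fun _ : Fin n => gg.prod (_root_.stdGaussian d))
    (f := fun _ => phi p q) (fun _ => (measurable_phi p q).aemeasurable)]
  simp_rw [map_phi hp hq hpq]
  rfl

/-- resampling one coordinate -/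
lemma pi_update_le {X : Type*} [MeasurableSpace X] (μ : Measure X) [IsProbabilityMeasure μ]
    {n : ℕ} (i : Fin n) {T : Set (Fin n → X)} (hT : MeasurableSet T) (ε : ENNReal)
    (h : ∀ z, (Measure.pi fun _ : Fin n => μ) {Y | Function.update Y i z ∈ T} ≤ ε) :
    (Measure.pi fun _ : Fin n => μ) T ≤ ε := by
  have hm : Measurable (fun y : X × (Fin n → X) => Function.update y.2 i y.1) := by
    refine measurable_pi_lambda _ fun j => ?_
    by_cases hj : j = i
    · subst hj; simpa using measurable_fst
    · simp only [Function.update_of_ne hj]; fun_prop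
  have key : (Measure.pi fun _ : Fin n => μ) =
      (μ.prod (Measure.pi fun _ : Fin n => μ)).map (fun y => Function.update y.2 i y.1) := by
    refine Measure.pi_eq fun s hs => ?_
    rw [Measure.map_apply hm (MeasurableSet.univ_pi hs)]
    have : (fun y : X × (Fin n → X) => Function.update y.2 i y.1) ⁻¹' (Set.univ.pi s) =
        s i ×ˢ (Set.univ.pi (Function.update s i Set.univ)) := by
      ext y
      simp only [Set.mem_preimage, Set.mem_pi, Set.mem_univ, true_imp_iff, Set.mem_prod]
      constructor
      · intro hy
        refine ⟨by simpa using hy i, fun j => ?_⟩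
        by_cases hj : j = i
        · subst hj; simp
        · simpa [Function.update_of_ne hj] using hy j
      · rintro ⟨h1, h2⟩ j
        by_cases hj : j = i
        · subst hj; simpa using h1
        · simpa [Function.update_of_ne hj] using h2 j
    rw [this, Measure.prod_prod, Measure.pi_pi]
    rw [← Finset.mul_prod_erase Finset.univ (fun j => μ (s j)) (Finset.mem_univ i),
      ← Finset.mul_prod_erase Finset.univ (fun j => μ (Function.update s i Set.univ j))
        (Finset.mem_univ i)]
    simp only [Function.update_self, measure_univ, one_mul]
    congr 1
    refine Finset.prod_congr rfl fun j hj => ?_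
    rw [Function.update_of_ne (Finset.ne_of_mem_erase hj)]
  rw [key, Measure.map_apply hm hT, Measure.prod_apply (hm hT)]
  calc _ ≤ ∫⁻ _, ε ∂μ := lintegral_mono fun z => h z
    _ = ε := by simp

/-- Chebyshev for weighted sums of i.i.d. variables -/
lemma cheb {X : Type*} [MeasurableSpace X] (μ : Measure X) [IsProbabilityMeasure μ]
    {n : ℕ} (f : X → ℝ) (hf : MemLp f 2 μ) (q : Fin n → ℝ) (t : ℝ) (ht : 0 < t) :
    (Measure.pi fun _ : Fin n => μ) {y | (∑ j, q j) * (∫ x, f x ∂μ) + t ≤ ∑ j, q j * f (y j)} ≤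
      ENNReal.ofReal ((∑ j, q j ^ 2) * Var[f; μ] / t ^ 2) := by
  have hL : ∀ j, MemLp (fun x => q j * f x) 2 μ := fun j => hf.const_mul _
  have hL' : ∀ j, MemLp (fun y : Fin n → X => q j * f (y j)) 2 (Measure.pi fun _ : Fin n => μ) :=
    fun j => (hL j).comp_measurePreserving (measurePreserving_eval (fun _ : Fin n => μ) j)
  have hS : MemLp (∑ j, fun y : Fin n → X => q j * f (y j)) 2 (Measure.pi fun _ : Fin n => μ) :=
    memLp_finsetSum' _ fun j _ => hL' j
  have hv := variance_sum_pi (μ := fun _ : Fin n => μ) (X := fun j x => q j * f x) hL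
  have hE : ∫ y, (∑ j, fun y : Fin n → X => q j * f (y j)) y ∂(Measure.pi fun _ : Fin n => μ) =
      (∑ j, q j) * (∫ x, f x ∂μ) := by
    simp only [Finset.sum_apply]
    rw [integral_finsetSum _ fun j _ => (hL' j).integrable (by norm_num), Finset.sum_mul]
    refine Finset.sum_congr rfl fun j _ => ?_
    rw [integral_const_mul]
    congr 1
    exact integral_comp_eval (μ := fun _ : Fin n => μ) (i := j) (f := f) hf.1
  have hc := meas_ge_le_variance_div_sq hS ht
  rw [hv, hE] at hc
  refine (measure_mono ?_).trans (hc.trans (ENNReal.ofReal_le_ofReal ?_))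
  · intro y hy
    simp only [Set.mem_ofPred_eq, Finset.sum_apply] at hy ⊢
    exact le_trans (by linarith) (le_abs_self _)
  · simp only [variance_const_mul, Finset.sum_mul]
    exact le_rfl

lemma gauss_tail (s : ℝ) (hs : 0 ≤ s) :
    gaussianReal 0 1 {x | s ≤ x ^ 2} ≤ ENNReal.ofReal (2 * Real.exp (-s / 2)) := by
  have h1 := measure_ge_le_exp_mul_mgf (μ := gaussianReal 0 1) (X := id) (t := √s) (√s)
    (Real.sqrt_nonneg _) (integrable_exp_mul_gaussianReal _)
  have h2 := measure_le_le_exp_mul_mgf (μ := gaussianReal 0 1) (X := id) (t := -√s) (-√s)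
    (by simp) (integrable_exp_mul_gaussianReal _)
  rw [mgf_id_gaussianReal] at h1 h2
  simp only [id] at h1 h2
  rw [← Real.exp_add] at h1 h2
  have hsub : {x : ℝ | s ≤ x ^ 2} ⊆ {x | √s ≤ x} ∪ {x | x ≤ -√s} := by
    intro x hx
    have : √s ≤ |x| := Real.sqrt_le_iff.2 ⟨abs_nonneg _, by simpa using hx⟩
    rcases le_abs.1 this with h | h
    · exact Or.inl h
    · exact Or.inr (by simp only [Set.mem_ofPred_eq]; linarith)
  have hss := Real.mul_self_sqrt hs
  refine (measure_mono hsub).trans ((measure_union_le _ _).trans ?_)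
  rw [← ofReal_measureReal, ← ofReal_measureReal, ← ENNReal.ofReal_add (by positivity) (by positivity)]
  refine ENNReal.ofReal_le_ofReal ?_
  have e1 : -√s * √s + (0 * √s + ((1:NNReal):ℝ) * √s ^ 2 / 2) = -s / 2 := by
    simp only [NNReal.coe_one, pow_two, hss, neg_mul]; ring
  have e2 : - -√s * -√s + (0 * -√s + ((1:NNReal):ℝ) * (-√s) ^ 2 / 2) = -s / 2 := by
    simp only [NNReal.coe_one, pow_two, hss, neg_mul, mul_neg, neg_neg]; ring
  rw [e1] at h1
  rw [e2] at h2
  linarith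

lemma exists_rho : ∃ δ > (0:ℝ), ∫ x, Real.exp (-x ^ 2) ∂(gaussianReal 0 1) = Real.exp (-(4 * δ)) := by
  set ρ := ∫ x, Real.exp (-x ^ 2) ∂(gaussianReal 0 1) with hρ
  have hi : Integrable (fun x : ℝ => Real.exp (-x ^ 2)) (gaussianReal 0 1) := by
    refine Integrable.of_bound (C := 1) (by fun_prop) (ae_of_all _ fun x => ?_)
    rw [Real.norm_eq_abs, abs_of_pos (Real.exp_pos _)]
    exact Real.exp_le_one_iff.2 (by nlinarith [sq_nonneg x])
  have h0 : 0 < ρ := integral_exp_pos hi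
  have h1 : ρ < 1 := by
    have : 0 < ∫ x, (1 - Real.exp (-x ^ 2)) ∂(gaussianReal 0 1) := by
      rw [integral_pos_iff_support_of_nonneg]
      · have : Function.support (fun x : ℝ => 1 - Real.exp (-x ^ 2)) = {0}ᶜ := by
          ext x
          simp only [Function.mem_support, Set.mem_compl_iff, Set.mem_singleton_iff]
          rw [not_iff_not, sub_eq_zero, eq_comm, Real.exp_eq_one_iff]
          simp
        have hna : NullSingletonClass (gaussianReal 0 1) := nullSingletonClass_gaussianReal (by simp)
        rw [this, prob_compl_eq_one_sub (measurableSet_singleton _)]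
        simp
      · intro x
        simp only [Pi.zero_apply, sub_nonneg]
        exact Real.exp_le_one_iff.2 (by nlinarith [sq_nonneg x])
      · exact (integrable_const _).sub hi
    rw [integral_sub (integrable_const _) hi] at this
    simp at this
    simpa [hρ] using this
  refine ⟨-Real.log ρ / 4, by have := Real.log_neg h0 h1; linarith, ?_⟩
  rw [show -(4 * (-Real.log ρ / 4)) = Real.log ρ by ring, Real.exp_log h0]

lemma prj_tail : ∃ δ > (0:ℝ), ∀ (d : ℕ) (p q : Fin d → ℝ), dot p p = 1 → dot q q = 1 →
    dot p q = 0 →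
    _root_.stdGaussian d {z | dot (prj p q z) (prj p q z) < δ * d} ≤
      ENNReal.ofReal (5 * Real.exp (-(δ / 4) * d)) := by
  obtain ⟨δ, hδ, hρ⟩ := exists_rho
  refine ⟨δ, hδ, fun d p q hp hq hpq => ?_⟩
  have hsub : {z | dot (prj p q z) (prj p q z) < δ * d} ⊆
      {z | dot z z ≤ 2 * δ * d} ∪ ({z | δ / 2 * d ≤ dot p z ^ 2} ∪ {z | δ / 2 * d ≤ dot q z ^ 2}) := by
    intro z hz
    simp only [Set.mem_ofPred_eq, Set.mem_union, dot_prj_prj hp hq hpq] at hz ⊢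
    by_contra! hcon
    nlinarith [hcon.1, hcon.2.1, hcon.2.2]
  have hlin : ∀ u : Fin d → ℝ, dot u u = 1 →
      _root_.stdGaussian d {z | δ / 2 * d ≤ dot u z ^ 2} ≤
        ENNReal.ofReal (2 * Real.exp (-(δ / 4) * d)) := by
    intro u hu
    have hm : Measurable (fun z : Fin d → ℝ => dot u z) := by fun_prop
    have h := gauss_tail (δ / 2 * d) (by positivity)
    rw [← map_dot_std u hu, Measure.map_apply hm (measurableSet_le (by fun_prop) (by fun_prop))] at h
    refine h.trans (le_of_eq ?_)
    congr 3
    ring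
  have hmain : _root_.stdGaussian d {z | dot z z ≤ 2 * δ * d} ≤
      ENNReal.ofReal (Real.exp (-(δ / 4) * d)) := by
    have hi : Integrable (fun z : Fin d → ℝ => Real.exp (-1 * dot z z)) (_root_.stdGaussian d) := by
      refine Integrable.of_bound (C := 1) (Measurable.aestronglyMeasurable (by fun_prop)) (ae_of_all _ fun x => ?_)
      rw [Real.norm_eq_abs, abs_of_pos (Real.exp_pos _)]
      exact Real.exp_le_one_iff.2 (by nlinarith [dot_self_nonneg' x])
    have h := measure_le_le_exp_mul_mgf (μ := _root_.stdGaussian d) (X := fun z => dot z z)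
      (t := -1) (2 * δ * d) (by norm_num) hi
    have hmgf : mgf (fun z => dot z z) (_root_.stdGaussian d) (-1) = Real.exp (-(4 * δ)) ^ d := by
      rw [mgf, ← hρ]
      have h1 : ∀ z : Fin d → ℝ, Real.exp (-1 * dot z z) = ∏ j, Real.exp (-(z j) ^ 2) := by
        intro z
        rw [← Real.exp_sum]
        simp [dot, pow_two]
      simp_rw [h1]
      rw [_root_.stdGaussian, integral_fintype_prod_eq_prod (𝕜 := ℝ)
        (f := fun j (x : ℝ) => Real.exp (-x ^ 2))]
      simp
    rw [hmgf, ← Real.exp_nat_mul, ← Real.exp_add] at h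
    rw [← ofReal_measureReal]
    refine ENNReal.ofReal_le_ofReal (h.trans (Real.exp_le_exp.2 ?_))
    have : 0 ≤ δ * d := by positivity
    nlinarith
  calc _ ≤ _ := measure_mono hsub
    _ ≤ _ := measure_union_le _ _
    _ ≤ _ := add_le_add hmain ((measure_union_le _ _).trans (add_le_add (hlin p hp) (hlin q hq)))
    _ = _ := by
      rw [← ENNReal.ofReal_add (by positivity) (by positivity),
        ← ENNReal.ofReal_add (by positivity) (by positivity)]
      congr 1
      ring

def k0 : ℝ := (√(2 * π))⁻¹ * Real.exp (-1) / 16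

lemma k0_pos : 0 < k0 := by
  unfold k0; positivity

lemma gauss_Icc (u : ℝ) :
    ENNReal.ofReal (k0 * Real.exp (-u ^ 2)) ≤ gaussianReal 0 1 (Set.Icc u (u + 1 / 16)) := by
  rw [gaussianReal_apply _ (by simp)]
  calc ENNReal.ofReal (k0 * Real.exp (-u ^ 2)) =
      ∫⁻ x in Set.Icc u (u + 1 / 16), ENNReal.ofReal ((√(2 * π))⁻¹ * Real.exp (-1 - u ^ 2)) := by
        rw [setLIntegral_const, Real.volume_Icc, ← ENNReal.ofReal_mul (by positivity)]
        congr 1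
        rw [sub_eq_add_neg, Real.exp_add, k0]
        ring
    _ ≤ _ := by
      refine setLIntegral_mono (by fun_prop) fun x hx => ?_
      rw [gaussianPDF]
      refine ENNReal.ofReal_le_ofReal ?_
      rw [gaussianPDFReal]
      simp only [NNReal.coe_one, mul_one, sub_zero]
      refine mul_le_mul_of_nonneg_left (Real.exp_le_exp.2 ?_) (by positivity)
      have h1 := hx.1
      have h2 := hx.2
      nlinarith [sq_nonneg (x - 2 * u), sq_nonneg (x - u), sq_nonneg u]

lemma none_prob {X : Type*} [MeasurableSpace X] (μ : Measure X) [IsProbabilityMeasure μ]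
    (n : ℕ) (R : Set X) (hR : MeasurableSet R) (p : ℝ) (hp : ENNReal.ofReal p ≤ μ R) :
    (Measure.pi fun _ : Fin n => μ) {A | ∀ i, A i ∉ R} ≤ ENNReal.ofReal (Real.exp (-p * n)) := by
  have : {A : Fin n → X | ∀ i, A i ∉ R} = Set.univ.pi fun _ => Rᶜ := by
    ext; simp
  rw [this, Measure.pi_pi]
  simp only [Finset.prod_const, Finset.card_univ, Fintype.card_fin]
  have h1 : μ Rᶜ ≤ ENNReal.ofReal (Real.exp (-p)) := by
    rw [prob_compl_eq_one_sub hR]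
    calc 1 - μ R ≤ 1 - ENNReal.ofReal p := tsub_le_tsub_left hp _
      _ ≤ _ := by
        rw [tsub_le_iff_right]
        have : (1 : ENNReal) = ENNReal.ofReal 1 := by simp
        rw [this]
        refine (ENNReal.ofReal_le_ofReal ?_).trans ENNReal.ofReal_add_le
        linarith [Real.add_one_le_exp (-p)]
  calc _ ≤ _ := pow_le_pow_left' h1 n
    _ = _ := by rw [← ENNReal.ofReal_pow (by positivity), ← Real.exp_nat_mul]; congr 2; ring

lemma dot_prj_left {d : ℕ} (p q x z : Fin d → ℝ) :
    dot (prj p q x) z = dot x z - dot p x * dot p z - dot q x * dot q z := by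
  simp only [prj, sub_dot', smul_dot']

lemma dot_p_phi {d : ℕ} {p q : Fin d → ℝ} (hp : dot p p = 1)
    (hpq : dot p q = 0) (y : (ℝ × ℝ) × (Fin d → ℝ)) : dot p (phi p q y) = y.1.1 := by
  simp only [phi, prj, dot_add', dot_sub', dot_smul', hp, hpq]
  ring

lemma dot_q_phi {d : ℕ} {p q : Fin d → ℝ} (hq : dot q q = 1)
    (hpq : dot p q = 0) (y : (ℝ × ℝ) × (Fin d → ℝ)) : dot q (phi p q y) = y.1.2 := by
  simp only [phi, prj, dot_add', dot_sub', dot_smul', hq, dot_comm' q p, hpq]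
  ring

lemma dot_prj_phi {d : ℕ} {p q : Fin d → ℝ} (hp : dot p p = 1) (hq : dot q q = 1)
    (hpq : dot p q = 0) (x : Fin d → ℝ) (y : (ℝ × ℝ) × (Fin d → ℝ)) :
    dot (prj p q x) (phi p q y) = dot (prj p q x) y.2 := by
  have h1 : dot (prj p q x) p = 0 := by
    rw [dot_prj_left, hp, dot_comm' q p, hpq, dot_comm' x p]; ring
  have h2 : dot (prj p q x) q = 0 := by
    rw [dot_prj_left, hq, hpq, dot_comm' x q]; ring
  rw [phi, dot_add', dot_add', dot_smul', dot_smul', h1, h2, dot_prj_prj hp hq hpq, dot_prj_left]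
  ring

/-- the weight bound -/
def qw (y : ℝ × ℝ) : ℝ := 9 * (y.1 ^ 2 + y.2 ^ 2)

def f4 (y : ℝ × ℝ) : ℝ := y.1 ^ 4 + y.2 ^ 4

lemma qw_sq (y : ℝ × ℝ) : qw y ^ 2 ≤ 162 * f4 y := by
  unfold qw f4
  nlinarith [sq_nonneg (y.1 ^ 2 - y.2 ^ 2)]

lemma qw_nonneg (y : ℝ × ℝ) : 0 ≤ qw y := by
  unfold qw; positivity

@[fun_prop]
lemma measurable_qw : Measurable qw := by unfold qw; fun_prop

@[fun_prop]
lemma measurable_f4 : Measurable f4 := by unfold f4; fun_prop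

/-- the good rectangle -/
def Rect (t b : ℝ) : Set (ℝ × ℝ) := Set.Icc t (t + 1 / 16) ×ˢ Set.Icc b (b + 1 / 16)

lemma weight_le {α β : ℝ} (hα : |α - 1| ≤ 1 / 3) (hβ0 : 0 < β) (hβ : β ≤ 1) (y : ℝ × ℝ) :
    3 * (α * y.1 + β * y.2) ^ 2 - y.1 ^ 2 ≤ qw y := by
  obtain ⟨h1, h2⟩ := abs_le.1 hα
  have hα2 : α ^ 2 ≤ 2 := by nlinarith
  have hβ2 : β ^ 2 ≤ 1 := by nlinarith
  unfold qw
  have : (α * y.1 + β * y.2) ^ 2 ≤ (α ^ 2 + β ^ 2) * (y.1 ^ 2 + y.2 ^ 2) := by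
    nlinarith [sq_nonneg (α * y.2 - β * y.1)]
  have h3 : (α ^ 2 + β ^ 2) * (y.1 ^ 2 + y.2 ^ 2) ≤ 3 * (y.1 ^ 2 + y.2 ^ 2) :=
    mul_le_mul_of_nonneg_right (by linarith) (by positivity)
  nlinarith [sq_nonneg y.1]

lemma weight_rect {α β t : ℝ} (hα : |α - 1| ≤ 1 / 3) (hβ0 : 0 < β) (hβ : β ≤ 1) (ht : 1 ≤ t)
    {y : ℝ × ℝ} (hy : y ∈ Rect t (-α * t / β)) :
    3 * (α * y.1 + β * y.2) ^ 2 - y.1 ^ 2 ≤ -(2 / 3) * t ^ 2 := by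
  obtain ⟨h1, h2⟩ := abs_le.1 hα
  obtain ⟨⟨ha, ha'⟩, ⟨hb, hb'⟩⟩ := hy
  set b0 := -α * t / β with hb0
  have hb0' : β * b0 = -α * t := by rw [hb0]; field_simp
  have e : α * y.1 + β * y.2 = α * (y.1 - t) + β * (y.2 - b0) := by
    linear_combination hb0'
  have l1 : 0 ≤ α * (y.1 - t) := mul_nonneg (by linarith) (by linarith)
  have l2 : α * (y.1 - t) ≤ 4 / 3 * (1 / 16) :=
    mul_le_mul (by linarith) (by linarith) (by linarith) (by norm_num)
  have l3 : 0 ≤ β * (y.2 - b0) := mul_nonneg hβ0.le (by linarith)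
  have l4 : β * (y.2 - b0) ≤ 1 * (1 / 16) :=
    mul_le_mul (by linarith) (by linarith) (by linarith) (by norm_num)
  rw [e]
  have : (α * (y.1 - t) + β * (y.2 - b0)) ^ 2 ≤ (1 / 3) ^ 2 :=
    pow_le_pow_left₀ (by linarith) (by linarith) 2
  nlinarith

/-- deterministic part -/
lemma det_part {n d : ℕ} {p q w : Fin d → ℝ} (hp : dot p p = 1) (hq : dot q q = 1)
    (hpq : dot p q = 0) {α β t L K : ℝ} (hw : w = α • p + β • q) (hα : |α - 1| ≤ 1 / 3)
    (hβ0 : 0 < β) (hβ : β ≤ 1) (ht : 1 ≤ t) (hL : 0 < L)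
    (y : (Fin n → ℝ × ℝ) × (Fin n → Fin d → ℝ)) (i : Fin n)
    (hi : y.1 i ∈ Rect t (-α * t / β))
    (hN : L ≤ dot (prj p q (y.2 i)) (prj p q (y.2 i)))
    (hS : ∑ j ∈ Finset.univ.erase i, qw (y.1 j) * dot (prj p q (y.2 i)) (y.2 j) ^ 2 ≤
      K * n * dot (prj p q (y.2 i)) (prj p q (y.2 i))) :
    ∃ u : Fin d → ℝ, nrm u = 1 ∧ hessQF p w u (Phi p q y) ≤ -(2 / 3) * t ^ 2 * L / n + K := by
  set v := prj p q (y.2 i) with hv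
  set N := dot v v with hNdef
  have hNpos : 0 < N := hL.trans_le hN
  have hsq : √N * √N = N := Real.mul_self_sqrt hNpos.le
  have hsN : 0 < √N := Real.sqrt_pos.2 hNpos
  have hn : (0:ℝ) < n := by
    have := i.pos
    exact_mod_cast this
  refine ⟨(√N)⁻¹ • v, ?_, ?_⟩
  · rw [nrm_eq', smul_dot', dot_smul', ← hNdef, ← mul_assoc, ← mul_inv, hsq,
      inv_mul_cancel₀ hNpos.ne', Real.sqrt_one]
  have hterm : ∀ j, (3 * (dot w (Phi p q y j)) ^ 2 - (dot p (Phi p q y j)) ^ 2) *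
      (dot ((√N)⁻¹ • v) (Phi p q y j)) ^ 2 =
      (3 * (α * (y.1 j).1 + β * (y.1 j).2) ^ 2 - (y.1 j).1 ^ 2) * (dot v (y.2 j) ^ 2 / N) := by
    intro j
    rw [hw, add_dot', smul_dot', smul_dot', smul_dot', Phi, dot_p_phi hp hpq, dot_q_phi hq hpq, hv,
      dot_prj_phi hp hq hpq, ← hv, mul_pow, inv_pow, pow_two (√N), hsq]
    ring
  have hvi : dot v (y.2 i) = N := by
    rw [hNdef, hv, dot_prj_prj hp hq hpq, dot_prj_left]
  unfold hessQF
  simp_rw [hterm]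
  rw [← Finset.add_sum_erase _ _ (Finset.mem_univ i), hvi]
  have hrest : ∑ j ∈ Finset.univ.erase i,
      (3 * (α * (y.1 j).1 + β * (y.1 j).2) ^ 2 - (y.1 j).1 ^ 2) * (dot v (y.2 j) ^ 2 / N) ≤ K * n := by
    calc _ ≤ ∑ j ∈ Finset.univ.erase i, qw (y.1 j) * (dot v (y.2 j) ^ 2 / N) :=
        Finset.sum_le_sum fun j _ => mul_le_mul_of_nonneg_right (weight_le hα hβ0 hβ _)
          (by positivity)
      _ = (∑ j ∈ Finset.univ.erase i, qw (y.1 j) * dot v (y.2 j) ^ 2) / N := by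
        rw [Finset.sum_div]; exact Finset.sum_congr rfl fun _ _ => by ring
      _ ≤ K * n := by rw [div_le_iff₀ hNpos]; exact hS
  have hfirst : (3 * (α * (y.1 i).1 + β * (y.1 i).2) ^ 2 - (y.1 i).1 ^ 2) * (N ^ 2 / N) ≤
      -(2 / 3) * t ^ 2 * L := by
    have hNN : N ^ 2 / N = N := by field_simp
    rw [hNN]
    have h1 := mul_le_mul_of_nonneg_right (weight_rect hα hβ0 hβ ht hi) hNpos.le
    have h2 : 0 ≤ t ^ 2 * (N - L) := mul_nonneg (sq_nonneg _) (by linarith)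
    nlinarith
  calc _ ≤ 1 / (n:ℝ) * (-(2 / 3) * t ^ 2 * L + K * n) :=
      mul_le_mul_of_nonneg_left (add_le_add hfirst hrest) (by positivity)
    _ = _ := by field_simp

lemma memLp_pow' (k : ℕ) : MemLp (fun x : ℝ => x ^ k) 2 (gaussianReal 0 1) := by
  rw [memLp_two_iff_integrable_sq (by fun_prop)]
  rcases Nat.eq_zero_or_pos k with rfl | hk
  · simp
  have h := (memLp_id_gaussianReal' (μ := 0) (v := 1) ((2 * k : ℕ) : ENNReal)
    (ENNReal.natCast_ne_top _)).integrable_norm_pow (by omega)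
  refine h.congr (ae_of_all _ fun x => ?_)
  simp only [id, Real.norm_eq_abs]
  rw [← pow_mul, mul_comm k 2, pow_mul, pow_mul, sq_abs]

lemma memLp_sq : MemLp (fun x : ℝ => x ^ 2) 2 (gaussianReal 0 1) := memLp_pow' 2

lemma memLp_f4 : MemLp f4 2 gg :=
  ((memLp_pow' 4).comp_fst (gaussianReal 0 1)).add ((memLp_pow' 4).comp_snd (gaussianReal 0 1))

/-- conditional Chebyshev -/
lemma cond_cheb {n d : ℕ} (p r : Fin d → ℝ) (q : Fin n → ℝ) (hq0 : ∀ j, 0 ≤ q j) {K m V L : ℝ}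
    (hm : m = ∫ x, x ^ 2 ∂(gaussianReal 0 1)) (hV : V = Var[fun x => x ^ 2; gaussianReal 0 1])
    (hq : ∑ j, q j ^ 2 ≤ K * n) (hL : 0 < L) (i : Fin n) :
    sample n d {Z | L ≤ dot (prj p r (Z i)) (prj p r (Z i)) ∧
      (m * ((1 + K) / 2) + 1) * n * dot (prj p r (Z i)) (prj p r (Z i)) ≤
        ∑ j ∈ Finset.univ.erase i, q j * dot (prj p r (Z i)) (Z j) ^ 2} ≤
      ENNReal.ofReal (K * V / n) := by
  have hn : (0:ℝ) < n := by
    have := i.pos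
    exact_mod_cast this
  have hm0 : 0 ≤ m := by rw [hm]; exact integral_nonneg fun x => sq_nonneg x
  have hV0 : 0 ≤ V := by rw [hV]; exact variance_nonneg _ _
  have hq1 : ∑ j, q j ≤ (1 + K) / 2 * n := by
    have : ∑ j, q j ≤ ∑ j : Fin n, (1 + q j ^ 2) / 2 :=
      Finset.sum_le_sum fun j _ => by nlinarith [sq_nonneg (q j - 1)]
    rw [← Finset.sum_div, Finset.sum_add_distrib] at this
    simp at this
    linarith
  refine pi_update_le (_root_.stdGaussian d) i ?_ _ fun z => ?_
  · have h1 : MeasurableSet {Z : Fin n → Fin d → ℝ | L ≤ dot (prj p r (Z i)) (prj p r (Z i))} :=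
      measurableSet_le (by fun_prop) (by fun_prop)
    have h2 : MeasurableSet {Z : Fin n → Fin d → ℝ |
        (m * ((1 + K) / 2) + 1) * n * dot (prj p r (Z i)) (prj p r (Z i)) ≤
        ∑ j ∈ Finset.univ.erase i, q j * dot (prj p r (Z i)) (Z j) ^ 2} :=
      measurableSet_le (by fun_prop) (by fun_prop)
    exact h1.inter h2
  set v := prj p r z with hv
  set N := dot v v with hN
  by_cases hNL : L ≤ N
  swap
  · have : {Y : Fin n → Fin d → ℝ | Function.update Y i z ∈ {Z | L ≤ dot (prj p r (Z i)) (prj p r (Z i)) ∧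
      (m * ((1 + K) / 2) + 1) * n * dot (prj p r (Z i)) (prj p r (Z i)) ≤
        ∑ j ∈ Finset.univ.erase i, q j * dot (prj p r (Z i)) (Z j) ^ 2}} = ∅ := by
      ext Y
      simp only [Set.mem_ofPred_eq, Function.update_self, Set.mem_empty_iff_false, iff_false, ← hv,
        ← hN]
      exact fun h => hNL h.1
    rw [this]; simp
  have hNpos : 0 < N := hL.trans_le hNL
  have hsq : √N * √N = N := Real.mul_self_sqrt hNpos.le
  have hsN : 0 < √N := Real.sqrt_pos.2 hNpos
  have hu : dot ((√N)⁻¹ • v) ((√N)⁻¹ • v) = 1 := by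
    rw [smul_dot', dot_smul', ← hN, ← mul_assoc, ← mul_inv, hsq, inv_mul_cancel₀ hNpos.ne']
  have hc := cheb (gaussianReal 0 1) (fun x => x ^ 2) memLp_sq q n hn
  rw [← hm, ← hV] at hc
  have hmd : Measurable (fun x : Fin d → ℝ => dot ((√N)⁻¹ • v) x) := by fun_prop
  have hpi : (Measure.pi fun _ : Fin n => _root_.stdGaussian d).map
      (fun Y j => dot ((√N)⁻¹ • v) (Y j)) = Measure.pi fun _ : Fin n => gaussianReal 0 1 := by
    have hs : ∀ _ : Fin n, SigmaFinite
        ((_root_.stdGaussian d).map (fun x => dot ((√N)⁻¹ • v) x)) := by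
      intro _; rw [map_dot_std _ hu]; infer_instance
    rw [Measure.pi_map_pi (μ := fun _ : Fin n => _root_.stdGaussian d)
      (f := fun _ x => dot ((√N)⁻¹ • v) x) (fun _ => hmd.aemeasurable)]
    simp_rw [map_dot_std _ hu]
  rw [← hpi, Measure.map_apply (by fun_prop) (measurableSet_le (by fun_prop) (by fun_prop))] at hc
  refine (measure_mono ?_).trans (hc.trans (ENNReal.ofReal_le_ofReal ?_))
  · intro Y hY
    simp only [Set.mem_ofPred_eq, Function.update_self, ← hv, ← hN] at hY
    obtain ⟨-, hY⟩ := hY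
    simp only [Set.mem_preimage, Set.mem_ofPred_eq]
    have e1 : ∑ j ∈ Finset.univ.erase i, q j * dot v (Function.update Y i z j) ^ 2 ≤
        ∑ j, q j * dot v (Y j) ^ 2 := by
      rw [Finset.sum_congr rfl fun j hj => by
        rw [Function.update_of_ne (Finset.ne_of_mem_erase hj)]]
      exact Finset.sum_le_sum_of_subset_of_nonneg (Finset.erase_subset _ _)
        fun j _ _ => mul_nonneg (hq0 j) (sq_nonneg _)
    have e2 : ∑ j, q j * dot ((√N)⁻¹ • v) (Y j) ^ 2 = (∑ j, q j * dot v (Y j) ^ 2) / N := by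
      rw [Finset.sum_div]
      refine Finset.sum_congr rfl fun j _ => ?_
      rw [smul_dot', mul_pow, inv_pow, pow_two (√N), hsq]
      ring
    rw [e2, le_div_iff₀ hNpos]
    refine le_trans ?_ (hY.trans e1)
    refine mul_le_mul_of_nonneg_right ?_ hNpos.le
    nlinarith [mul_le_mul_of_nonneg_right hq1 hm0]
  · rw [div_le_div_iff₀ (by positivity) hn]
    nlinarith [mul_le_mul_of_nonneg_right hq (mul_nonneg hV0 hn.le)]

lemma rect_prob (t b : ℝ) :
    ENNReal.ofReal (k0 ^ 2 * Real.exp (-(t ^ 2 + b ^ 2))) ≤ gg (Rect t b) := by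
  rw [Rect, Measure.prod_prod]
  refine le_trans (le_of_eq ?_) (mul_le_mul' (gauss_Icc t) (gauss_Icc b))
  have := k0_pos
  rw [← ENNReal.ofReal_mul (by positivity), neg_add, Real.exp_add]
  congr 1
  ring

/-- the conditional (on the first two coordinates) failure event -/
def Tset (n d : ℕ) (p q : Fin d → ℝ) (R : Set (ℝ × ℝ)) (L K' M : ℝ) :
    Set ((Fin n → ℝ × ℝ) × (Fin n → Fin d → ℝ)) :=
  {y | (∃ i, y.1 i ∈ R) ∧ (∑ j, f4 (y.1 j) < M) ∧ ∀ i, y.1 i ∈ R →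
    (dot (prj p q (y.2 i)) (prj p q (y.2 i)) < L ∨
      (L ≤ dot (prj p q (y.2 i)) (prj p q (y.2 i)) ∧
        K' * n * dot (prj p q (y.2 i)) (prj p q (y.2 i)) ≤
        ∑ j ∈ Finset.univ.erase i, qw (y.1 j) * dot (prj p q (y.2 i)) (y.2 j) ^ 2))}

lemma measurableSet_Tset (n d : ℕ) (p q : Fin d → ℝ) (R : Set (ℝ × ℝ)) (hR : MeasurableSet R)
    (L K' M : ℝ) : MeasurableSet (Tset n d p q R L K' M) := by
  have hRi : ∀ i, MeasurableSet {y : (Fin n → ℝ × ℝ) × (Fin n → Fin d → ℝ) | y.1 i ∈ R} :=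
    fun i => hR.preimage (by fun_prop : Measurable
      fun y : (Fin n → ℝ × ℝ) × (Fin n → Fin d → ℝ) => y.1 i)
  have h1 : MeasurableSet (⋃ i, {y : (Fin n → ℝ × ℝ) × (Fin n → Fin d → ℝ) | y.1 i ∈ R}) :=
    MeasurableSet.iUnion hRi
  have h2 : MeasurableSet {y : (Fin n → ℝ × ℝ) × (Fin n → Fin d → ℝ) | ∑ j, f4 (y.1 j) < M} :=
    measurableSet_lt (Finset.measurable_sum _ fun j _ => measurable_f4.comp (by fun_prop))
      (by fun_prop)
  have h3 : ∀ i, MeasurableSet {y : (Fin n → ℝ × ℝ) × (Fin n → Fin d → ℝ) |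
      dot (prj p q (y.2 i)) (prj p q (y.2 i)) < L} := fun i =>
    measurableSet_lt (by fun_prop) (by fun_prop)
  have h4 : ∀ i, MeasurableSet {y : (Fin n → ℝ × ℝ) × (Fin n → Fin d → ℝ) |
      L ≤ dot (prj p q (y.2 i)) (prj p q (y.2 i))} := fun i =>
    measurableSet_le (by fun_prop) (by fun_prop)
  have h5 : ∀ i, MeasurableSet {y : (Fin n → ℝ × ℝ) × (Fin n → Fin d → ℝ) |
      K' * n * dot (prj p q (y.2 i)) (prj p q (y.2 i)) ≤
        ∑ j ∈ Finset.univ.erase i, qw (y.1 j) * dot (prj p q (y.2 i)) (y.2 j) ^ 2} := fun i =>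
    measurableSet_le (by fun_prop) (Finset.measurable_sum _ fun j _ =>
      (measurable_qw.comp (by fun_prop)).mul (by fun_prop))
  have h6 := h1.inter (h2.inter (MeasurableSet.iInter fun i =>
    (hRi i).compl.union ((h3 i).union ((h4 i).inter (h5 i)))))
  convert h6 using 1
  ext y
  simp only [Tset, Set.mem_ofPred_eq, Set.mem_inter_iff, Set.mem_iUnion, Set.mem_iInter,
    Set.mem_union, Set.mem_compl_iff, imp_iff_not_or]

set_option maxHeartbeats 4000000 in
lemma core {C c δ m2 V2 m4 V4 K : ℝ}
    (hδ : 0 < δ)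
    (htail : ∀ (d : ℕ) (p q : Fin d → ℝ), dot p p = 1 → dot q q = 1 → dot p q = 0 →
      _root_.stdGaussian d {z | dot (prj p q z) (prj p q z) < δ * d} ≤
      ENNReal.ofReal (5 * Real.exp (-(δ / 4) * d)))
    (hm2 : m2 = ∫ x, x ^ 2 ∂(gaussianReal 0 1)) (hV2 : V2 = Var[fun x => x ^ 2; gaussianReal 0 1])
    (hm4 : m4 = ∫ x, f4 x ∂gg) (hV4 : V4 = Var[f4; gg])
    (hK : K = 162 * (m4 + 1))
    (hC6 : 6 ≤ C) (hCV : V4 + K * V2 ≤ C) (hCK : m2 * ((1 + K) / 2) + 1 ≤ C)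
    (hc0 : 0 < c) (hcδ : c ≤ 3 * δ / 25) (hck : c ≤ k0 ^ 2)
    (n d : ℕ) {p q w : Fin d → ℝ} (hp : dot p p = 1) (hq : dot q q = 1)
    (hpq : dot p q = 0) {α β : ℝ} (hw : w = α • p + β • q) (hα : |α - 1| ≤ 1 / 3)
    (hβ0 : 0 < β) (hβ : β ≤ 1) (hd : C ≤ d) (hn : C * Real.exp (C / β ^ 2) ≤ n) :
    1 - C * Real.exp (-c * d) - C / n -
            Real.exp (-(c * Real.exp (-C / β ^ 2)) * Real.sqrt n) ≤
          (sample n d {x | ∃ u : Fin d → ℝ, nrm u = 1 ∧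
              hessQF p w u x ≤ -c * β ^ 2 * ((d : ℝ) * Real.log n) / n + C}).toReal := by
  set S := {x : Fin n → Fin d → ℝ | ∃ u : Fin d → ℝ, nrm u = 1 ∧
              hessQF p w u x ≤ -c * β ^ 2 * ((d : ℝ) * Real.log n) / n + C} with hS
  have hV20 : 0 ≤ V2 := by rw [hV2]; exact variance_nonneg _ _
  have hm40 : 0 ≤ m4 := by rw [hm4]; exact integral_nonneg fun x => by unfold f4; positivity
  have hV40 : 0 ≤ V4 := by rw [hV4]; exact variance_nonneg _ _
  have hK0 : 0 < K := by rw [hK]; linarith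
  have hn6 : 6 ≤ (n:ℝ) := by
    have : 1 ≤ Real.exp (C / β ^ 2) := Real.one_le_exp (by positivity)
    nlinarith
  have hnpos : 0 < (n:ℝ) := by linarith
  have hd0 : 0 < (d:ℝ) := by linarith
  have hlog : C / β ^ 2 ≤ Real.log n := by
    rw [Real.le_log_iff_exp_le hnpos]
    nlinarith [Real.exp_pos (C / β ^ 2)]
  have hlogβ : C ≤ Real.log n * β ^ 2 := by rwa [div_le_iff₀ (by positivity)] at hlog
  set t := √(9 / 50 * β ^ 2 * Real.log n) with ht
  have hlog0 : 0 < Real.log n := Real.log_pos (by linarith)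
  have ht2 : t ^ 2 = 9 / 50 * β ^ 2 * Real.log n := Real.sq_sqrt (by positivity)
  have ht1 : 1 ≤ t := by
    rw [ht, Real.one_le_sqrt]; nlinarith
  set R := Rect t (-α * t / β) with hR
  have hRm : MeasurableSet R := measurableSet_Icc.prod measurableSet_Icc
  set L := δ * d with hL
  have hL0 : 0 < L := by positivity
  set K' := m2 * ((1 + K) / 2) + 1 with hK'
  set M := (n:ℝ) * m4 + n with hM
  set μA := Measure.pi fun _ : Fin n => gg with hμA
  -- bound for B1
  have hB1 : μA {A | ∀ i, A i ∉ R} ≤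
      ENNReal.ofReal (Real.exp (-(c * Real.exp (-C / β ^ 2)) * Real.sqrt n)) := by
    refine (none_prob gg n R hRm _ (rect_prob _ _)).trans (ENNReal.ofReal_le_ofReal ?_)
    rw [Real.exp_le_exp]
    have hexp : t ^ 2 + (-α * t / β) ^ 2 ≤ Real.log n / 2 := by
      have : (-α * t / β) ^ 2 = α ^ 2 * (9 / 50 * Real.log n) := by
        rw [div_pow, mul_pow, ht2]; field_simp
      rw [this, ht2]
      obtain ⟨h1, h2⟩ := abs_le.1 hα
      have hα2 : α ^ 2 ≤ 16 / 9 := by nlinarith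
      have hβ2 : β ^ 2 ≤ 1 := by nlinarith
      have h5 := mul_le_mul_of_nonneg_right (add_le_add hα2 hβ2) hlog0.le
      linarith only [h5]
    have hsn : Real.exp (Real.log n / 2) = √n := by
      rw [Real.sqrt_eq_rpow, Real.rpow_def_of_pos hnpos]; congr 1; ring
    have hsn0 : 0 < √(n:ℝ) := Real.sqrt_pos.2 hnpos
    have h1 : √(n:ℝ) ≤ Real.exp (-(t ^ 2 + (-α * t / β) ^ 2)) * n := by
      calc √(n:ℝ) = Real.exp (-(Real.log n / 2)) * n := by
            rw [Real.exp_neg, hsn]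
            field_simp
            exact Real.sq_sqrt hnpos.le
        _ ≤ _ := by gcongr
    have h2 : Real.exp (-C / β ^ 2) ≤ 1 := by
      rw [Real.exp_le_one_iff, neg_div]
      have : 0 ≤ C / β ^ 2 := by positivity
      linarith
    have h3 : c * Real.exp (-C / β ^ 2) * √n ≤ k0 ^ 2 * (Real.exp (-(t ^ 2 + (-α * t / β) ^ 2)) * n) := by
      refine mul_le_mul ?_ h1 hsn0.le (by positivity)
      nlinarith
    linarith
  -- bound for B2
  have hB2 : μA {A | M ≤ ∑ j, f4 (A j)} ≤ ENNReal.ofReal (V4 / n) := by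
    have h := cheb gg f4 memLp_f4 (fun _ : Fin n => (1:ℝ)) n hnpos
    rw [← hm4, ← hV4] at h
    simp only [one_mul, Finset.sum_const, Finset.card_univ, Fintype.card_fin, nsmul_eq_mul, mul_one,
      one_pow] at h
    refine h.trans (le_of_eq ?_)
    congr 1
    field_simp
  -- bound for T
  have hT : (μA.prod (sample n d)) (Tset n d p q R L K' M) ≤
      ENNReal.ofReal (5 * Real.exp (-(δ / 4) * d)) + ENNReal.ofReal (K * V2 / n) := by
    rw [Measure.prod_apply (measurableSet_Tset n d p q R hRm L K' M)]
    calc _ ≤ ∫⁻ _, (ENNReal.ofReal (5 * Real.exp (-(δ / 4) * d)) +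
          ENNReal.ofReal (K * V2 / n)) ∂μA := lintegral_mono fun A => ?_
      _ = _ := by simp
    by_cases hA : (∃ i, A i ∈ R) ∧ (∑ j, f4 (A j) < M)
    swap
    · have : Prod.mk A ⁻¹' Tset n d p q R L K' M = ∅ := by
        ext Z
        simp only [Tset, Set.mem_preimage, Set.mem_ofPred_eq, Set.mem_empty_iff_false, iff_false]
        exact fun h => hA ⟨h.1, h.2.1⟩
      rw [this]; simp
    obtain ⟨⟨i, hi⟩, hAM⟩ := hA
    have hqs : ∑ j, qw (A j) ^ 2 ≤ K * n := by
      calc _ ≤ ∑ j, 162 * f4 (A j) := Finset.sum_le_sum fun j _ => qw_sq _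
        _ ≤ _ := by rw [← Finset.mul_sum, hK]; nlinarith
    have hcc := cond_cheb (d := d) p q (fun j => qw (A j)) (fun j => qw_nonneg _) hm2 hV2 hqs hL0 i
    have htl : sample n d {Z | dot (prj p q (Z i)) (prj p q (Z i)) < L} ≤
        ENNReal.ofReal (5 * Real.exp (-(δ / 4) * d)) := by
      have hpres := measurePreserving_eval (fun _ : Fin n => _root_.stdGaussian d) i
      refine le_trans (le_of_eq ?_) (htail d p q hp hq hpq)
      have hms : MeasurableSet {z : Fin d → ℝ | dot (prj p q z) (prj p q z) < δ * d} :=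
        measurableSet_lt (by fun_prop) (by fun_prop)
      exact hpres.measure_preimage hms.nullMeasurableSet
    refine le_trans (measure_mono ?_) ((measure_union_le _ _).trans (add_le_add htl hcc))
    intro Z hZ
    exact hZ.2.2 i hi
  -- the good event
  have hbad : (Phi p q ⁻¹' S)ᶜ ⊆ (({A | ∀ i, A i ∉ R} ×ˢ Set.univ) ∪
      ({A | M ≤ ∑ j, f4 (A j)} ×ˢ Set.univ)) ∪ Tset n d p q R L K' M := by
    intro y hy
    by_contra hcon
    simp only [Set.mem_union, Set.mem_prod, Set.mem_univ, and_true, Set.mem_ofPred_eq, not_or,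
      not_forall, not_not, not_le] at hcon
    obtain ⟨⟨⟨i0, hi0⟩, hM'⟩, hTn⟩ := hcon
    have : ∃ i, y.1 i ∈ R ∧ ¬ (dot (prj p q (y.2 i)) (prj p q (y.2 i)) < L ∨
      (L ≤ dot (prj p q (y.2 i)) (prj p q (y.2 i)) ∧
        K' * n * dot (prj p q (y.2 i)) (prj p q (y.2 i)) ≤
        ∑ j ∈ Finset.univ.erase i, qw (y.1 j) * dot (prj p q (y.2 i)) (y.2 j) ^ 2)) := by
      by_contra hno
      apply hTn
      refine ⟨⟨i0, hi0⟩, hM', fun i hi => ?_⟩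
      by_contra h
      exact hno ⟨i, hi, h⟩
    obtain ⟨i, hi, hgood⟩ := this
    rw [not_or, not_lt, not_and, not_le] at hgood
    obtain ⟨u, hu1, hu2⟩ := det_part hp hq hpq hw hα hβ0 hβ ht1 hL0 y i hi hgood.1
      (hgood.2 hgood.1).le
    apply hy
    refine ⟨u, hu1, hu2.trans (add_le_add ?_ hCK)⟩
    rw [ht2, hL]
    refine (div_le_div_iff_of_pos_right hnpos).2 ?_
    have hx : 0 ≤ β ^ 2 * (d * Real.log n) := by positivity
    nlinarith [mul_le_mul_of_nonneg_right hcδ hx]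
  have hmeas : (μA.prod (sample n d)) (Phi p q ⁻¹' S)ᶜ ≤
      ENNReal.ofReal (C * Real.exp (-c * d) + C / n +
        Real.exp (-(c * Real.exp (-C / β ^ 2)) * Real.sqrt n)) := by
    have e1 : (μA.prod (sample n d)) ({A | ∀ i, A i ∉ R} ×ˢ Set.univ) = μA {A | ∀ i, A i ∉ R} := by
      rw [Measure.prod_prod]; simp
    have e2 : (μA.prod (sample n d)) ({A | M ≤ ∑ j, f4 (A j)} ×ˢ Set.univ) =
        μA {A | M ≤ ∑ j, f4 (A j)} := by
      rw [Measure.prod_prod]; simp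
    refine (measure_mono hbad).trans ((measure_union_le _ _).trans ((add_le_add
      ((measure_union_le _ _).trans (add_le_add (e1.trans_le hB1) (e2.trans_le hB2))) hT).trans ?_))
    rw [← ENNReal.ofReal_add (by positivity) (by positivity),
      ← ENNReal.ofReal_add (by positivity) (by positivity),
      ← ENNReal.ofReal_add (by positivity) (by positivity)]
    refine ENNReal.ofReal_le_ofReal ?_
    have g1 : 5 * Real.exp (-(δ / 4) * d) ≤ C * Real.exp (-c * d) := by
      refine mul_le_mul (by linarith) (Real.exp_le_exp.2 ?_) (by positivity) (by linarith)
      nlinarith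
    have g2 : V4 / n + K * V2 / n ≤ C / n := by
      rw [← add_div]; gcongr
    linarith
  have hone : 1 ≤ (μA.prod (sample n d)) (Phi p q ⁻¹' S) +
      (μA.prod (sample n d)) (Phi p q ⁻¹' S)ᶜ := by
    rw [← measure_univ (μ := μA.prod (sample n d)), ← Set.union_compl_self (Phi p q ⁻¹' S)]
    exact measure_union_le _ _
  have hle : (μA.prod (sample n d)) (Phi p q ⁻¹' S) ≤ sample n d S := by
    conv_rhs => rw [← map_Phi hp hq hpq]
    exact Measure.le_map_apply (measurable_Phi p q).aemeasurable S
  have hfin : 1 ≤ sample n d S + ENNReal.ofReal (C * Real.exp (-c * d) + C / n +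
        Real.exp (-(c * Real.exp (-C / β ^ 2)) * Real.sqrt n)) :=
    hone.trans (add_le_add hle hmeas)
  have hC0 : 0 ≤ C := by linarith
  have := ENNReal.toReal_mono (by finiteness) hfin
  rw [ENNReal.toReal_add (by finiteness) (by finiteness), ENNReal.toReal_ofReal (by positivity)] at this
  simp only [ENNReal.toReal_one] at this
  linarith


/-- **Theorem 2.1**: for a fixed `w ∈ R_loc` with `β = ‖P^⊥ w‖ > 0`, if `d ≥ C` and
`n ≥ C e^{C/β²}`, then with probability at least
`1 - C e^{-cd} - C/n - e^{-c e^{-C/β²} √n}`,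
`min_{u ∈ S^{d-1}} u^⊤ ∇²L(w) u ≤ -c β² (d log n)/n + C`. -/
theorem stmt0 :
    ∃ C > (0 : ℝ), ∃ c > (0 : ℝ),
      ∀ (n d : ℕ) (wstar w : Fin d → ℝ),
        nrm wstar = 1 → Rloc wstar w →
        C ≤ (d : ℝ) →
        C * Real.exp (C / (nrm (perpPart wstar w)) ^ 2) ≤ (n : ℝ) →
        1 - C * Real.exp (-c * d) - C / n -
            Real.exp (-(c * Real.exp (-C / (nrm (perpPart wstar w)) ^ 2)) * Real.sqrt n) ≤
          (sample n d {x | ∃ u : Fin d → ℝ, nrm u = 1 ∧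
              hessQF wstar w u x ≤
                -c * (nrm (perpPart wstar w)) ^ 2 * ((d : ℝ) * Real.log n) / n + C}).toReal := by
  obtain ⟨δ, hδ, htail⟩ := prj_tail
  obtain ⟨m2, hm2⟩ : ∃ m2, m2 = ∫ x, x ^ 2 ∂(gaussianReal 0 1) := ⟨_, rfl⟩
  obtain ⟨V2, hV2⟩ : ∃ V2, V2 = Var[fun x => x ^ 2; gaussianReal 0 1] := ⟨_, rfl⟩
  obtain ⟨m4, hm4⟩ : ∃ m4, m4 = ∫ x, f4 x ∂gg := ⟨_, rfl⟩
  obtain ⟨V4, hV4⟩ : ∃ V4, V4 = Var[f4; gg] := ⟨_, rfl⟩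
  obtain ⟨K, hK⟩ : ∃ K, K = 162 * (m4 + 1) := ⟨_, rfl⟩
  have hk := k0_pos
  refine ⟨max 6 (max (V4 + K * V2) (m2 * ((1 + K) / 2) + 1)), by positivity,
    min (3 * δ / 25) (k0 ^ 2), by positivity, ?_⟩
  intro n d wstar w hws hR hd hn
  obtain ⟨hα, hβ0, hβ⟩ := hR
  set β := nrm (perpPart wstar w) with hβdef
  have hp : dot wstar wstar = 1 := by rw [← nrm_sq', hws]; norm_num
  have hββ : dot (perpPart wstar w) (perpPart wstar w) = β ^ 2 := (nrm_sq' _).symm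
  have hperp : dot wstar (perpPart wstar w) = 0 := by
    rw [perpPart, dot_sub', dot_smul', hp, dot_comm' w wstar]; ring
  refine core hδ htail hm2 hV2 hm4 hV4 hK (le_max_left _ _)
    ((le_max_left _ _).trans (le_max_right _ _)) ((le_max_right _ _).trans (le_max_right _ _))
    (by positivity) (min_le_left _ _) (min_le_right _ _) n d hp
    (q := β⁻¹ • perpPart wstar w) ?_ ?_ (α := dot w wstar) ?_ hα hβ0 hβ hd hn
  · rw [smul_dot', dot_smul', hββ]; field_simp
  · rw [dot_smul', hperp, mul_zero]
  · rw [smul_smul, mul_inv_cancel₀ hβ0.ne', one_smul, perpPart]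
    simp
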